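/- arXiv:2602.02224 — 5 statements merged into one kernel-verified Lean document; each statement's English description precedes it below -/
import Mathlib

section
/- Let W be a real m×n matrix with nonzero columns W_1,…,W_n, frame operator F = W Wᵀ, fractional dimensionality D_i = ‖W_i‖⁴/(W_iᵀ F W_i), and rank(W) = m. If the capacity bound is saturated, i.e. ∑_{i=1}^n D_i = m, then every column W_i is an eigenvector of F with some positive eigenvalue λ; equivalently, for each i the spectral measure of W_i with respect to F is a single Dirac mass at a positive eigenvalue (F W_i = λ W_i for some λ > 0). -/
open Matrix

/-- **Spectral Localization.**
Let `W` be a real `m × n` matrix with nonzero columns, frame operator `F = W * Wᵀ`,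
fractional dimensionality `D i = ‖Wᵢ‖⁴ / (Wᵢᵀ F Wᵢ)`, and `rank W = m`.
If the capacity bound is saturated, `∑ i, D i = m`, then every column `Wᵢ` is an
eigenvector of `F` with a positive eigenvalue. -/
theorem spectral_localization (m n : ℕ) (W : Matrix (Fin m) (Fin n) ℝ)
    (hcols : ∀ i : Fin n, Wᵀ i ≠ 0)
    (hrank : W.rank = m)
    (hsat : ∑ i : Fin n,
        ((Wᵀ i) ⬝ᵥ (Wᵀ i)) ^ 2 / ((Wᵀ i) ⬝ᵥ (W * Wᵀ).mulVec (Wᵀ i)) = (m : ℝ)) :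
    ∀ i : Fin n, ∃ lam : ℝ, 0 < lam ∧ (W * Wᵀ).mulVec (Wᵀ i) = lam • (Wᵀ i) := by
  have hunit : IsUnit (W * Wᵀ) := by
    have hr : (W * Wᵀ).rank = Fintype.card (Fin m) := by
      rw [Matrix.rank_self_mul_transpose, hrank, Fintype.card_fin]
    rw [← Matrix.mulVec_surjective_iff_isUnit]
    have htop : LinearMap.range (W * Wᵀ).mulVecLin = ⊤ := by
      apply Submodule.eq_top_of_finrank_eq
      rw [Module.finrank_fintype_fun_eq_card]
      exact hr
    exact LinearMap.range_eq_top.1 htop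
  have hdet : IsUnit (W * Wᵀ).det := (Matrix.isUnit_iff_isUnit_det _).1 hunit
  have hq : ∀ x y : Fin m → ℝ, x ⬝ᵥ (W * Wᵀ).mulVec y = (Wᵀ *ᵥ x) ⬝ᵥ (Wᵀ *ᵥ y) := by
    intro x y
    rw [← Matrix.mulVec_mulVec, Matrix.dotProduct_mulVec, Matrix.mulVec_transpose W x]
  have hb : ∀ i, 0 < (Wᵀ i) ⬝ᵥ (W * Wᵀ).mulVec (Wᵀ i) := by
    intro i
    rw [hq]
    refine lt_of_le_of_ne (Finset.sum_nonneg fun j _ => mul_self_nonneg _) fun h => ?_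
    have h0 := dotProduct_self_eq_zero.1 h.symm
    have h1 : (Wᵀ i) ⬝ᵥ (Wᵀ i) = 0 := congrFun h0 i
    exact hcols i (dotProduct_self_eq_zero.1 h1)
  have ha : ∀ i, 0 < (Wᵀ i) ⬝ᵥ (Wᵀ i) := fun i =>
    lt_of_le_of_ne (Finset.sum_nonneg fun j _ => mul_self_nonneg _)
      fun h => hcols i (dotProduct_self_eq_zero.1 h.symm)
  have hFu : ∀ w : Fin m → ℝ, (W * Wᵀ) *ᵥ ((W * Wᵀ)⁻¹ *ᵥ w) = w := by
    intro w
    rw [Matrix.mulVec_mulVec, Matrix.mul_nonsing_inv _ hdet, Matrix.one_mulVec]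
  have hc : ∑ i : Fin n, (Wᵀ i) ⬝ᵥ ((W * Wᵀ)⁻¹ *ᵥ (Wᵀ i)) = (m : ℝ) := by
    have h1 : (Wᵀ * ((W * Wᵀ)⁻¹ * W)).trace = (m : ℝ) := by
      rw [Matrix.trace_mul_comm, Matrix.mul_assoc, Matrix.nonsing_inv_mul _ hdet,
        Matrix.trace_one, Fintype.card_fin]
    rw [← h1]
    rfl
  -- the residual quadratic form
  have hres : ∀ i (t : ℝ), t = (Wᵀ i) ⬝ᵥ (Wᵀ i) / ((Wᵀ i) ⬝ᵥ (W * Wᵀ).mulVec (Wᵀ i)) →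
      (Wᵀ *ᵥ ((W * Wᵀ)⁻¹ *ᵥ (Wᵀ i) - t • Wᵀ i)) ⬝ᵥ (Wᵀ *ᵥ ((W * Wᵀ)⁻¹ *ᵥ (Wᵀ i) - t • Wᵀ i))
      = (Wᵀ i) ⬝ᵥ ((W * Wᵀ)⁻¹ *ᵥ (Wᵀ i)) -
        ((Wᵀ i) ⬝ᵥ (Wᵀ i)) ^ 2 / ((Wᵀ i) ⬝ᵥ (W * Wᵀ).mulVec (Wᵀ i)) := by
    intro i t ht
    have hbi := (hb i).ne'
    have e1 := hq ((W * Wᵀ)⁻¹ *ᵥ (Wᵀ i)) ((W * Wᵀ)⁻¹ *ᵥ (Wᵀ i))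
    have e2 := hq (Wᵀ i) ((W * Wᵀ)⁻¹ *ᵥ (Wᵀ i))
    have e3 := hq (Wᵀ i) (Wᵀ i)
    rw [hFu] at e1 e2
    rw [dotProduct_comm] at e1
    rw [Matrix.mulVec_sub, Matrix.mulVec_smul, sub_dotProduct, dotProduct_sub, dotProduct_sub,
      smul_dotProduct, smul_dotProduct, dotProduct_smul, dotProduct_smul,
      dotProduct_comm (Wᵀ *ᵥ ((W * Wᵀ)⁻¹ *ᵥ (Wᵀ i))) (Wᵀ *ᵥ (Wᵀ i)), ← e1, ← e2, ← e3, ht]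
    simp only [smul_eq_mul]
    field_simp
    ring
  intro i
  have hsum : ∑ i : Fin n, ((Wᵀ i) ⬝ᵥ ((W * Wᵀ)⁻¹ *ᵥ (Wᵀ i)) -
        ((Wᵀ i) ⬝ᵥ (Wᵀ i)) ^ 2 / ((Wᵀ i) ⬝ᵥ (W * Wᵀ).mulVec (Wᵀ i))) = 0 := by
    rw [Finset.sum_sub_distrib, hc, hsat, sub_self]
  have hz := (Finset.sum_eq_zero_iff_of_nonneg (fun j _ => by
    rw [← hres j _ rfl]
    exact Finset.sum_nonneg fun k _ => mul_self_nonneg _)).1 hsum i (Finset.mem_univ i)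
  rw [← hres i _ rfl] at hz
  have hv := dotProduct_self_eq_zero.1 hz
  have hF := congrArg (fun x => W *ᵥ x) hv
  simp only [Matrix.mulVec_zero] at hF
  rw [Matrix.mulVec_mulVec, Matrix.mulVec_sub, hFu, Matrix.mulVec_smul, sub_eq_zero] at hF
  have ht := div_pos (ha i) (hb i)
  refine ⟨_, inv_pos.2 ht, ?_⟩
  rw [eq_inv_smul_iff₀ ht.ne']
  exact hF.symm
end

section
/- Let W be a real m×n matrix with nonzero columns each of which is an eigenvector of the frame operator F = W Wᵀ: F W_i = λ(i) W_i with λ(i) > 0. Let λ_1,…,λ_r be the distinct values of λ(i), define clusters C_k = {i : λ(i) = λ_k} and subspaces V_k = span{W_i : i ∈ C_k}. Then the clusters C_k partition {1,…,n}, the subspaces V_k are pairwise orthogonal, F = ∑_{k=1}^r λ_k P_{V_k} on Im(W) (and F = 0 on ker(Wᵀ)), and within each cluster the columns form a tight frame for V_k: ∑_{i∈C_k} W_i W_iᵀ acts as λ_k · Id on V_k. -/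
open Matrix

/-- **Decomposition into Tight Frames.**
Suppose each nonzero column `Wᵢ` of `W` is an eigenvector of the frame operator
`F = W * Wᵀ` with eigenvalue `lam i > 0`.  With clusters `C c = {i : lam i = c}` and
subspaces `V c = span {Wᵢ : i ∈ C c}`:
the clusters partition `{1,…,n}`, the subspaces are pairwise orthogonal,
`F` acts as `c • id` on `V c` and as `0` on `ker Wᵀ`, `Im W` is spanned by the `V c`,
and within each cluster the columns form a tight frame for `V c` with frame constant `c`. -/
theorem decomposition_into_tight_frames (m n : ℕ) (W : Matrix (Fin m) (Fin n) ℝ)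
    (hcols : ∀ i : Fin n, Wᵀ i ≠ 0)
    (lam : Fin n → ℝ) (hpos : ∀ i, 0 < lam i)
    (heig : ∀ i, (W * Wᵀ).mulVec (Wᵀ i) = lam i • (Wᵀ i))
    (C : ℝ → Finset (Fin n)) (hC : ∀ c, C c = Finset.univ.filter (fun i => lam i = c))
    (V : ℝ → Submodule ℝ (Fin m → ℝ))
    (hV : ∀ c, V c = Submodule.span ℝ ((fun i => Wᵀ i) '' (C c : Set (Fin n)))) :
    -- the clusters partition the index set
    ((∀ i : Fin n, i ∈ C (lam i)) ∧
      ∀ c c' : ℝ, c ≠ c' → Disjoint (C c) (C c')) ∧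
    -- the cluster subspaces are pairwise orthogonal
    (∀ c c' : ℝ, c ≠ c' → ∀ u ∈ V c, ∀ v ∈ V c', u ⬝ᵥ v = 0) ∧
    -- F = ∑ λ_k P_{V_k} on Im(W):  F acts as c • id on each V c, and Im W = ⨆ V c
    (∀ c : ℝ, ∀ v ∈ V c, (W * Wᵀ).mulVec v = c • v) ∧
    ((⨆ c ∈ Set.range lam, V c) = LinearMap.range W.mulVecLin) ∧
    -- F = 0 on ker(Wᵀ)
    (∀ v : Fin m → ℝ, Wᵀ.mulVec v = 0 → (W * Wᵀ).mulVec v = 0) ∧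
    -- tight frame within each cluster:  ∑_{i ∈ C c} Wᵢ Wᵢᵀ = c • Id on V c
    (∀ c : ℝ, ∀ v ∈ V c, ∑ i ∈ C c, ((Wᵀ i) ⬝ᵥ v) • (Wᵀ i) = c • v) := by
  have hmem : ∀ i c, i ∈ C c ↔ lam i = c := by
    intro i c
    rw [hC]; simp
  have hWV : ∀ i, Wᵀ i ∈ V (lam i) := by
    intro i
    rw [hV]
    exact Submodule.subset_span ⟨i, by simp [hmem], rfl⟩
  have hF : ∀ c : ℝ, ∀ v ∈ V c, (W * Wᵀ).mulVec v = c • v := by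
    intro c v hv
    rw [hV] at hv
    induction hv using Submodule.span_induction with
    | mem x hx =>
      obtain ⟨i, hi, rfl⟩ := hx
      have hi' : lam i = c := (hmem i c).1 (by simpa using hi)
      rw [← hi']
      exact heig i
    | zero => simp
    | add x y _ _ hx hy => rw [Matrix.mulVec_add, hx, hy, smul_add]
    | smul a x _ hx => rw [Matrix.mulVec_smul, hx, smul_comm]
  have hsymm : ∀ u v : Fin m → ℝ, (W * Wᵀ).mulVec u ⬝ᵥ v = u ⬝ᵥ (W * Wᵀ).mulVec v := by
    intro u v
    rw [Matrix.dotProduct_mulVec, ← Matrix.mulVec_transpose, Matrix.transpose_mul,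
      Matrix.transpose_transpose]
  have horth : ∀ c c' : ℝ, c ≠ c' → ∀ u ∈ V c, ∀ v ∈ V c', u ⬝ᵥ v = 0 := by
    intro c c' hcc u hu v hv
    have h := hsymm u v
    rw [hF c u hu, hF c' v hv, smul_dotProduct, dotProduct_smul, smul_eq_mul, smul_eq_mul] at h
    have h2 : (c - c') * (u ⬝ᵥ v) = 0 := by linarith
    exact (mul_eq_zero.1 h2).resolve_left (sub_ne_zero.2 hcc)
  have hexp : ∀ x : Fin n → ℝ, W.mulVec x = ∑ i, x i • Wᵀ i := by
    intro x
    ext j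
    simp [Matrix.mulVec, dotProduct, mul_comm]
  refine ⟨⟨fun i => (hmem i _).2 rfl, ?_⟩, horth, hF, ?_, ?_, ?_⟩
  · intro c c' hcc
    rw [Finset.disjoint_left]
    intro i hi hi'
    exact hcc (((hmem i c).1 hi).symm.trans ((hmem i c').1 hi'))
  · apply le_antisymm
    · refine iSup₂_le fun c _ => ?_
      rw [hV, Submodule.span_le]
      rintro _ ⟨i, _, rfl⟩
      refine ⟨Pi.single i 1, ?_⟩
      ext j
      simp [Matrix.mulVecLin_apply]
    · rintro _ ⟨x, rfl⟩
      rw [Matrix.mulVecLin_apply, hexp]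
      refine Submodule.sum_mem _ fun i _ => Submodule.smul_mem _ _ ?_
      exact (le_iSup₂_of_le (f := fun c (_ : c ∈ Set.range lam) => V c)
        (lam i) ⟨i, rfl⟩ le_rfl) (hWV i)
  · intro v hv
    rw [← Matrix.mulVec_mulVec, hv, Matrix.mulVec_zero]
  · intro c v hv
    rw [← hF c v hv, ← Matrix.mulVec_mulVec, hexp]
    refine Finset.sum_subset (Finset.subset_univ _) fun i _ hi => ?_
    have hne : lam i ≠ c := fun h => hi ((hmem i c).2 h)
    rw [horth (lam i) c hne _ (hWV i) v hv, zero_smul]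
end

section
/- Let W ∈ ℝ^{m×n} with nonzero columns w_1,…,w_n, frame operator F = W Wᵀ, r = rank(W), leverage scores ℓ_i = w_iᵀ F⁺ w_i (F⁺ the Moore–Penrose pseudoinverse), fractional dimensionalities D_i = ‖w_i‖⁴/(w_iᵀ F w_i), and relative slacks σ_i = 1 − D_i/ℓ_i. Then: (1) ∑_{i=1}^n ℓ_i = r; (2) D_i ≤ ℓ_i for all i, with equality if and only if w_i is an eigenvector of F; (3) r − ∑_{i=1}^n D_i = ∑_{i=1}^n ℓ_i σ_i. -/
open Matrix

theorem aux_trace_idem {m : ℕ} (P : Matrix (Fin m) (Fin m) ℝ) (h : P * P = P) :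
    P.trace = (P.rank : ℝ) := by
  have hi : IsIdempotentElem (Matrix.toLin' P) := by
    unfold IsIdempotentElem
    rw [Module.End.mul_eq_comp, ← Matrix.toLin'_mul, h]
  have := (LinearMap.IsIdempotentElem.isProj_range _ hi).trace
  rw [Matrix.trace_toLin'_eq] at this
  rw [this]
  rfl

theorem aux_dot {m n : ℕ} (W : Matrix (Fin m) (Fin n) ℝ) (x y : Fin m → ℝ) :
    x ⬝ᵥ (W * Wᵀ).mulVec y = (Wᵀ.mulVec x) ⬝ᵥ (Wᵀ.mulVec y) := by
  rw [← Matrix.mulVec_mulVec, Matrix.dotProduct_mulVec, Matrix.mulVec_transpose W x]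

/-- **Defect decomposition.**
Let `W ∈ ℝ^{m×n}` have nonzero columns, frame operator `F = W * Wᵀ`, and let `Fp` be the
Moore–Penrose pseudoinverse of `F` (characterized by the four Penrose conditions).
With leverage scores `ℓ i = wᵢᵀ F⁺ wᵢ`, fractional dimensionalities
`D i = ‖wᵢ‖⁴/(wᵢᵀ F wᵢ)` and relative slacks `σ i = 1 - D i / ℓ i`:
(1) `∑ ℓ i = rank W`;
(2) `D i ≤ ℓ i`, with equality iff `wᵢ` is an eigenvector of `F`;
(3) `rank W - ∑ D i = ∑ ℓ i * σ i`. -/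
theorem defect_decomposition (m n : ℕ) (W : Matrix (Fin m) (Fin n) ℝ)
    (hcols : ∀ i : Fin n, Wᵀ i ≠ 0)
    (Fp : Matrix (Fin m) (Fin m) ℝ)
    (hp1 : (W * Wᵀ) * Fp * (W * Wᵀ) = W * Wᵀ)
    (hp2 : Fp * (W * Wᵀ) * Fp = Fp)
    (hp3 : ((W * Wᵀ) * Fp)ᵀ = (W * Wᵀ) * Fp)
    (hp4 : (Fp * (W * Wᵀ))ᵀ = Fp * (W * Wᵀ))
    (ℓ D σ : Fin n → ℝ)
    (hl : ∀ i, ℓ i = (Wᵀ i) ⬝ᵥ Fp.mulVec (Wᵀ i))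
    (hD : ∀ i, D i = ((Wᵀ i) ⬝ᵥ (Wᵀ i)) ^ 2 / ((Wᵀ i) ⬝ᵥ (W * Wᵀ).mulVec (Wᵀ i)))
    (hσ : ∀ i, σ i = 1 - D i / ℓ i) :
    (∑ i : Fin n, ℓ i = (W.rank : ℝ)) ∧
    (∀ i : Fin n, D i ≤ ℓ i ∧
      (D i = ℓ i ↔ ∃ c : ℝ, (W * Wᵀ).mulVec (Wᵀ i) = c • (Wᵀ i))) ∧
    ((W.rank : ℝ) - ∑ i : Fin n, D i = ∑ i : Fin n, ℓ i * σ i) := by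
  have hPW : W * Wᵀ * Fp * W = W := by
    have h0 : (W * Wᵀ * Fp - 1) * (W * Wᴴ) = 0 := by
      rw [Matrix.conjTranspose_eq_transpose_of_trivial, Matrix.sub_mul, hp1, Matrix.one_mul,
        sub_self]
    rw [Matrix.mul_self_mul_conjTranspose_eq_zero, Matrix.sub_mul, Matrix.one_mul] at h0
    exact sub_eq_zero.1 h0
  have hcol : ∀ i, (W * Wᵀ).mulVec (Fp.mulVec (Wᵀ i)) = Wᵀ i := by
    intro i
    rw [Matrix.mulVec_mulVec]
    ext j
    exact congrFun (congrFun hPW j) i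
  have h1 : ∑ i : Fin n, ℓ i = (W.rank : ℝ) := by
    have e1 : ∑ i : Fin n, ℓ i = (Wᵀ * (Fp * W)).trace := by
      unfold Matrix.trace
      refine Finset.sum_congr rfl fun i _ => ?_
      rw [hl i]
      rfl
    have e2 : (Wᵀ * (Fp * W)).trace = (W * Wᵀ * Fp).trace := by
      rw [← Matrix.mul_assoc, Matrix.trace_mul_comm, ← Matrix.mul_assoc]
    have e3 : (W * Wᵀ * Fp).rank = W.rank := by
      apply le_antisymm
      · rw [Matrix.mul_assoc]
        exact Matrix.rank_mul_le_left _ _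
      · conv_lhs => rw [← hPW]
        exact Matrix.rank_mul_le_left _ _
    rw [e1, e2, aux_trace_idem, e3]
    rw [← Matrix.mul_assoc, hp1]
  have h2 : ∀ i : Fin n, 0 < D i ∧ D i ≤ ℓ i ∧
      (D i = ℓ i ↔ ∃ c : ℝ, (W * Wᵀ).mulVec (Wᵀ i) = c • (Wᵀ i)) := by
    intro i
    have hw := hcols i
    have hu := hcol i
    have hli := hl i
    have hDi := hD i
    generalize Wᵀ i = w at *
    generalize Fp.mulVec w = u at *
    have hww : 0 < w ⬝ᵥ w :=
      lt_of_le_of_ne (Finset.sum_nonneg fun j _ => mul_self_nonneg _)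
        (fun h => hw (dotProduct_self_eq_zero.1 h.symm))
    have d1 : w ⬝ᵥ w = (Wᵀ.mulVec w) ⬝ᵥ (Wᵀ.mulVec u) := by
      rw [← aux_dot, hu]
    have d2 := aux_dot W w w
    have d3 : ℓ i = (Wᵀ.mulVec u) ⬝ᵥ (Wᵀ.mulVec u) := by
      rw [← aux_dot, hu, hli, dotProduct_comm]
    have hWa : W.mulVec (Wᵀ.mulVec w) = (W * Wᵀ).mulVec w := Matrix.mulVec_mulVec _ _ _
    have hWb : W.mulVec (Wᵀ.mulVec u) = w := by rw [Matrix.mulVec_mulVec, hu]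
    have hc : u ⬝ᵥ (W * Wᵀ).mulVec w = w ⬝ᵥ w := by
      rw [aux_dot, dotProduct_comm, d1]
    generalize Wᵀ.mulVec w = a at *
    generalize Wᵀ.mulVec u = b at *
    have haa : 0 < a ⬝ᵥ a := by
      refine lt_of_le_of_ne (Finset.sum_nonneg fun j _ => mul_self_nonneg _) (fun h => ?_)
      have : a = 0 := dotProduct_self_eq_zero.1 h.symm
      rw [this, zero_dotProduct] at d1
      exact hww.ne' d1
    have hgap : ℓ i - D i = (b - ((w ⬝ᵥ w) / (a ⬝ᵥ a)) • a) ⬝ᵥ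
        (b - ((w ⬝ᵥ w) / (a ⬝ᵥ a)) • a) := by
      rw [hDi, d3, d2]
      simp only [sub_dotProduct, dotProduct_sub, smul_dotProduct, dotProduct_smul, smul_eq_mul]
      rw [dotProduct_comm b a, ← d1]
      field_simp
      ring
    refine ⟨?_, ?_, ?_, ?_⟩
    · rw [hDi, d2]
      positivity
    · have : 0 ≤ ℓ i - D i := by
        rw [hgap]
        exact Finset.sum_nonneg fun j _ => mul_self_nonneg _
      linarith
    · intro h
      rw [h, sub_self] at hgap
      have hb := sub_eq_zero.1 (dotProduct_self_eq_zero.1 hgap.symm)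
      have ht : (w ⬝ᵥ w) / (a ⬝ᵥ a) ≠ 0 := (div_pos hww haa).ne'
      generalize (w ⬝ᵥ w) / (a ⬝ᵥ a) = t at *
      refine ⟨t⁻¹, ?_⟩
      rw [← hWa]
      conv_rhs => rw [← hWb, hb, Matrix.mulVec_smul, smul_smul, inv_mul_cancel₀ ht, one_smul]
    · rintro ⟨c, hcw⟩
      rw [hcw, dotProduct_smul, smul_eq_mul] at d2 hc
      have hc0 : c ≠ 0 := by
        rintro rfl
        rw [zero_mul] at d2
        exact haa.ne d2
      rw [hDi, hcw, dotProduct_smul, smul_eq_mul, hli, dotProduct_comm w u]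
      have := hww.ne'
      field_simp
      linarith
  refine ⟨h1, fun i => (h2 i).2, ?_⟩
  rw [← h1, ← Finset.sum_sub_distrib]
  refine Finset.sum_congr rfl fun i _ => ?_
  have : ℓ i ≠ 0 := (lt_of_lt_of_le (h2 i).1 (h2 i).2.1).ne'
  rw [hσ i]
  field_simp
end

section
/- Let W ∈ ℝ^{m×n} with nonzero columns w_1,…,w_n, frame operator F = W Wᵀ, r = rank(W) > 0, leverage scores ℓ_i = w_iᵀ F⁺ w_i, fractional dimensionalities D_i = ‖w_i‖⁴/(w_iᵀ F w_i), and relative slacks σ_i = 1 − D_i/ℓ_i. If ∑_{i=1}^n D_i ≥ (1−ε) r for some ε ≥ 0, then for every τ ∈ (0,1): (1/r) ∑_{i : σ_i ≥ τ} ℓ_i ≤ ε/τ. -/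
open Matrix

/-- **Delocalized residue bound under ε-saturation.**
With `F = W * Wᵀ`, `Fp` its Moore–Penrose pseudoinverse, leverage scores
`ℓ i = wᵢᵀ F⁺ wᵢ`, fractional dimensionalities `D i = ‖wᵢ‖⁴/(wᵢᵀ F wᵢ)` and slacks
`σ i = 1 - D i / ℓ i`: if `rank W = r > 0` and `∑ D i ≥ (1-ε) r`, then for every
`τ ∈ (0,1)`, `(1/r) ∑_{i : σ i ≥ τ} ℓ i ≤ ε/τ`. -/
theorem delocalized_residue_bound (m n : ℕ) (W : Matrix (Fin m) (Fin n) ℝ)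
    (hcols : ∀ i : Fin n, Wᵀ i ≠ 0)
    (hrank : 0 < W.rank)
    (Fp : Matrix (Fin m) (Fin m) ℝ)
    (hp1 : (W * Wᵀ) * Fp * (W * Wᵀ) = W * Wᵀ)
    (hp2 : Fp * (W * Wᵀ) * Fp = Fp)
    (hp3 : ((W * Wᵀ) * Fp)ᵀ = (W * Wᵀ) * Fp)
    (hp4 : (Fp * (W * Wᵀ))ᵀ = Fp * (W * Wᵀ))
    (ℓ D σ : Fin n → ℝ)
    (hl : ∀ i, ℓ i = (Wᵀ i) ⬝ᵥ Fp.mulVec (Wᵀ i))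
    (hD : ∀ i, D i = ((Wᵀ i) ⬝ᵥ (Wᵀ i)) ^ 2 / ((Wᵀ i) ⬝ᵥ (W * Wᵀ).mulVec (Wᵀ i)))
    (hσ : ∀ i, σ i = 1 - D i / ℓ i)
    (ε : ℝ) (hε : 0 ≤ ε)
    (hsat : (1 - ε) * (W.rank : ℝ) ≤ ∑ i : Fin n, D i)
    (τ : ℝ) (hτ0 : 0 < τ) (hτ1 : τ < 1) :
    (1 / (W.rank : ℝ)) * ∑ i ∈ Finset.univ.filter (fun i => τ ≤ σ i), ℓ i ≤ ε / τ := by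
  have hFs : (W * Wᵀ)ᵀ = W * Wᵀ := by simp [Matrix.transpose_mul]
  have hX : Fpᵀ = Fp := by
    set A := W * Wᵀ with hA
    have e3 : Fpᵀ * A = A * Fp := by rw [← hp3, Matrix.transpose_mul, hFs]
    have e4 : A * Fpᵀ = Fp * A := by rw [← hp4, Matrix.transpose_mul, hFs]
    have q1 : A * Fpᵀ * A = A := by rw [Matrix.mul_assoc, e3, ← Matrix.mul_assoc]; simpa [Matrix.transpose_mul, hFs, Matrix.mul_assoc, e3] using congrArg Matrix.transpose hp1
    have q2 : Fpᵀ * A * Fpᵀ = Fpᵀ := by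
      simpa [Matrix.transpose_mul, hFs, Matrix.mul_assoc] using congrArg Matrix.transpose hp2
    have a1 : A * Fp = (A * Fpᵀ) * (A * Fp) := by
      rw [← Matrix.mul_assoc, q1]
    have a2 : A * Fp = (A * Fp) * (A * Fpᵀ) := by
      have := congrArg Matrix.transpose a1
      rw [Matrix.transpose_mul (A * Fpᵀ), hp3, e4, hp4, ← e4] at this
      exact this
    have a3 : A * Fp = A * Fpᵀ := by
      rw [a2, ← Matrix.mul_assoc, hp1]
    calc Fpᵀ = Fpᵀ * A * Fpᵀ := q2.symm
      _ = Fpᵀ * (A * Fp) := by rw [Matrix.mul_assoc, a3]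
      _ = (A * Fp) * Fp := by rw [← Matrix.mul_assoc, e3]
      _ = Fp * A * Fp := by rw [a3, e4]
      _ = Fp := hp2
  obtain ⟨P, hP⟩ : ∃ P, P = Wᵀ * Fp * W := ⟨_, rfl⟩
  have hPs : Pᵀ = P := by
    rw [hP]; simp [Matrix.transpose_mul, hX, Matrix.mul_assoc]
  have hPP : P * P = P := by
    calc P * P = Wᵀ * (Fp * (W * Wᵀ) * Fp) * W := by rw [hP]; simp only [Matrix.mul_assoc]
      _ = P := by rw [hp2, hP]
  have hWP : W * P = W := by
    have h0 : (W * P - W) * (W * P - W)ᵀ = 0 := by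
      have h1 : W * P * Wᵀ = W * Wᵀ := by
        rw [← hp1, hP]; simp only [Matrix.mul_assoc]
        
      rw [Matrix.transpose_sub, Matrix.transpose_mul, hPs, Matrix.sub_mul, Matrix.mul_sub, Matrix.mul_sub,
        ← Matrix.mul_assoc, Matrix.mul_assoc W P P, hPP, ← Matrix.mul_assoc, h1]
      simp
    have h2 : W * P - W = 0 := by
      rw [← Matrix.conjTranspose_eq_transpose_of_trivial] at h0
      exact Matrix.self_mul_conjTranspose_eq_zero.1 h0
    exact sub_eq_zero.1 h2
  have hrk : P.rank = W.rank := by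
    apply le_antisymm
    · rw [hP]; exact Matrix.rank_mul_le_right _ _
    · conv_lhs => rw [← hWP]
      exact Matrix.rank_mul_le_right _ _
  have htr : P.trace = W.rank := by
    have hid : IsIdempotentElem (Matrix.toLin' P) := by
      rw [IsIdempotentElem, Module.End.mul_eq_comp, ← Matrix.toLin'_mul, hPP]
    have := (LinearMap.IsIdempotentElem.isProj_range _ hid).trace
    rw [Matrix.trace_toLin'_eq] at this
    rw [this, ← hrk]
    rfl
  have hlP : ∀ i, ℓ i = P i i := by
    intro i
    rw [hl, hP, Matrix.mul_assoc]
    simp only [Matrix.mul_apply, dotProduct, Matrix.mulVec, Matrix.transpose_apply]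
  obtain ⟨G, hG⟩ : ∃ G, G = Wᵀ * W := ⟨_, rfl⟩
  have hGP : G * P = G := by rw [hG, Matrix.mul_assoc, hWP]
  have hGs : Gᵀ = G := by rw [hG]; simp [Matrix.transpose_mul]
  have hGi : ∀ i, Wᵀ i ⬝ᵥ Wᵀ i = G i i := by
    intro i; rw [hG]; rfl
  have hQ : ∀ i, (Wᵀ i) ⬝ᵥ (W * Wᵀ).mulVec (Wᵀ i) = ∑ k, G i k ^ 2 := by
    intro i
    have : (Wᵀ i) ⬝ᵥ (W * Wᵀ).mulVec (Wᵀ i) = (G * G) i i := by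
      have : G * G = Wᵀ * ((W * Wᵀ) * W) := by rw [hG]; simp only [Matrix.mul_assoc]
      rw [this, Matrix.mul_apply]
      rfl
    rw [this, Matrix.mul_apply]
    refine Finset.sum_congr rfl fun k _ => ?_
    rw [sq, ← congrFun (congrFun hGs k) i, Matrix.transpose_apply]
  have hPi : ∀ i, P i i = ∑ k, P k i ^ 2 := by
    intro i
    conv_lhs => rw [← hPP, Matrix.mul_apply]
    refine Finset.sum_congr rfl fun k _ => ?_
    rw [sq, ← congrFun (congrFun hPs i) k, Matrix.transpose_apply]
  have hGpos : ∀ i, 0 < G i i := by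
    intro i
    rw [← hGi]
    refine lt_of_le_of_ne (Finset.sum_nonneg fun k _ => mul_self_nonneg _) ?_
    intro h
    exact hcols i (dotProduct_self_eq_zero.1 h.symm)
  have hCS : ∀ i, G i i ^ 2 ≤ (∑ k, G i k ^ 2) * P i i := by
    intro i
    have h1 : G i i = ∑ k, G i k * P k i := by
      conv_lhs => rw [← hGP, Matrix.mul_apply]
    rw [h1, hPi]
    exact Finset.sum_mul_sq_le_sq_mul_sq _ _ _
  have hQpos : ∀ i, 0 < ∑ k, G i k ^ 2 := fun i =>
    lt_of_lt_of_le (pow_pos (hGpos i) 2)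
      (Finset.single_le_sum (f := fun k => G i k ^ 2) (fun k _ => sq_nonneg _) (Finset.mem_univ i))
  have hDl : ∀ i, D i ≤ ℓ i := by
    intro i
    rw [hD, hlP, hGi, hQ, div_le_iff₀ (hQpos i), mul_comm]
    exact hCS i
  have hlpos : ∀ i, 0 < ℓ i := by
    intro i
    refine lt_of_lt_of_le ?_ (hDl i)
    rw [hD, hGi, hQ]
    exact div_pos (pow_pos (hGpos i) 2) (hQpos i)
  have hsum : ∑ i, ℓ i = W.rank := by
    rw [← htr, Matrix.trace]
    exact Finset.sum_congr rfl fun i _ => hlP i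
  have hkey : τ * ∑ i ∈ Finset.univ.filter (fun i => τ ≤ σ i), ℓ i ≤ ε * W.rank := by
    calc τ * ∑ i ∈ Finset.univ.filter (fun i => τ ≤ σ i), ℓ i
        ≤ ∑ i ∈ Finset.univ.filter (fun i => τ ≤ σ i), (ℓ i - D i) := by
          rw [Finset.mul_sum]
          refine Finset.sum_le_sum fun i hi => ?_
          have h1 := (Finset.mem_filter.1 hi).2
          have h2 := mul_le_mul_of_nonneg_right h1 (hlpos i).le
          rw [hσ, sub_mul, div_mul_cancel₀ _ (hlpos i).ne', one_mul] at h2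
          exact h2
      _ ≤ ∑ i, (ℓ i - D i) :=
          Finset.sum_le_sum_of_subset_of_nonneg (Finset.filter_subset _ _)
            fun i _ _ => sub_nonneg.2 (hDl i)
      _ ≤ ε * W.rank := by
          rw [Finset.sum_sub_distrib, hsum]; linarith
  have hr : (0 : ℝ) < W.rank := by exact_mod_cast hrank
  rw [le_div_iff₀ hτ0, one_div, mul_assoc, inv_mul_le_iff₀ hr]
  linarith
end

section
/- Let L : ℝ^{n×n} → ℝ be Fréchet differentiable with respect to the Frobenius inner product, and define L̃ : ℝ^{m×n} → ℝ by L̃(W) = L(Wᵀ W). Then the gradient of L̃ is ∇_W L̃(W) = W Φ(W), where Φ(W) = ∇L(WᵀW) + (∇L(WᵀW))ᵀ. Consequently, if W : ℝ → ℝ^{m×n} is differentiable and follows the gradient flow Ẇ(t) = −∇_W L̃(W(t)), then the Gram matrix M(t) = W(t)ᵀ W(t) satisfies the anticommutator flow Ṁ(t) = −(M(t) Φ(t) + Φ(t) M(t)), with Φ(t) = Φ(W(t)). -/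
open Matrix

attribute [local instance]
  Matrix.frobeniusNormedAddCommGroup Matrix.frobeniusNormedSpace

theorem gram_isBoundedBilinearMap (m n : ℕ) :
    IsBoundedBilinearMap ℝ
      (fun p : Matrix (Fin m) (Fin n) ℝ × Matrix (Fin m) (Fin n) ℝ => p.1ᵀ * p.2) where
  add_left := by intro a b c; simp [Matrix.add_mul]
  smul_left := by intro r a b; simp
  add_right := by intro a b c; simp [Matrix.mul_add]
  smul_right := by intro r a b; simp
  bound := by
    refine ⟨1, one_pos, fun a b => ?_⟩
    have h := Matrix.frobenius_norm_mul aᵀ b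
    rw [Matrix.frobenius_norm_transpose] at h
    simpa using h

theorem gram_hasFDerivAt (m n : ℕ) (W : Matrix (Fin m) (Fin n) ℝ) :
    ∃ D : Matrix (Fin m) (Fin n) ℝ →L[ℝ] Matrix (Fin n) (Fin n) ℝ,
      (∀ H, D H = Wᵀ * H + Hᵀ * W) ∧
      HasFDerivAt (fun V : Matrix (Fin m) (Fin n) ℝ => Vᵀ * V) D W := by
  have h := (gram_isBoundedBilinearMap m n).hasFDerivAt (W, W)
  have h2 := HasFDerivAt.comp
    (f := fun V : Matrix (Fin m) (Fin n) ℝ => (V, V)) W h ((hasFDerivAt_id W).prodMk (hasFDerivAt_id W))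
  exact ⟨_, fun H => rfl, h2⟩

/-- **Gradient of the Gram loss and the anticommutator flow.**
Let `L : ℝ^{n×n} → ℝ` be Fréchet differentiable w.r.t. the Frobenius inner product,
with gradient `G` (`dL(M)[H] = tr((G M)ᵀ H)`), and define `L̃(W) = L(Wᵀ W)` and
`Φ(W) = G(WᵀW) + G(WᵀW)ᵀ`.  Then `∇_W L̃(W) = W Φ(W)`
(`dL̃(W)[H] = tr((W Φ(W))ᵀ H)`); consequently, along the gradient flow
`Ẇ = −∇_W L̃(W) = −W Φ(W)` the Gram matrix `M(t) = W(t)ᵀ W(t)` satisfies the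
anticommutator flow `Ṁ = −(M Φ + Φ M)`. -/
theorem gram_anticommutator_flow (m n : ℕ)
    (L : Matrix (Fin n) (Fin n) ℝ → ℝ) (hdiff : Differentiable ℝ L)
    (G : Matrix (Fin n) (Fin n) ℝ → Matrix (Fin n) (Fin n) ℝ)
    (hG : ∀ M H : Matrix (Fin n) (Fin n) ℝ, fderiv ℝ L M H = ((G M)ᵀ * H).trace)
    (Φ : Matrix (Fin m) (Fin n) ℝ → Matrix (Fin n) (Fin n) ℝ)
    (hΦ : ∀ W : Matrix (Fin m) (Fin n) ℝ, Φ W = G (Wᵀ * W) + (G (Wᵀ * W))ᵀ) :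
    -- ∇_W L̃(W) = W Φ(W)
    (∀ W H : Matrix (Fin m) (Fin n) ℝ,
      fderiv ℝ (fun V : Matrix (Fin m) (Fin n) ℝ => L (Vᵀ * V)) W H
        = ((W * Φ W)ᵀ * H).trace) ∧
    -- gradient flow on W induces the anticommutator flow on the Gram matrix
    (∀ Wc : ℝ → Matrix (Fin m) (Fin n) ℝ,
      (∀ t : ℝ, HasDerivAt Wc (-(Wc t * Φ (Wc t))) t) →
      ∀ t : ℝ, HasDerivAt (fun s : ℝ => (Wc s)ᵀ * Wc s)
        (-(((Wc t)ᵀ * Wc t) * Φ (Wc t) + Φ (Wc t) * ((Wc t)ᵀ * Wc t))) t) := by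
  refine ⟨fun W H => ?_, fun Wc hW t => ?_⟩
  · obtain ⟨D, hD, hd⟩ := gram_hasFDerivAt m n W
    have h := HasFDerivAt.comp
      (f := fun V : Matrix (Fin m) (Fin n) ℝ => Vᵀ * V) W (hdiff (Wᵀ * W)).hasFDerivAt hd
    have h' : fderiv ℝ (fun V : Matrix (Fin m) (Fin n) ℝ => L (Vᵀ * V)) W
        = (fderiv ℝ L (Wᵀ * W)).comp D := h.fderiv
    rw [h', ContinuousLinearMap.comp_apply, hG, hD, hΦ]
    generalize G (Wᵀ * W) = A
    have e : (Aᵀ * (Hᵀ * W)).trace = (A * (Wᵀ * H)).trace := by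
      rw [← Matrix.trace_transpose, Matrix.transpose_mul, Matrix.transpose_mul,
        Matrix.transpose_transpose, Matrix.transpose_transpose, Matrix.trace_mul_comm]
    rw [Matrix.mul_add, Matrix.trace_add, e]
    simp only [Matrix.transpose_mul, Matrix.transpose_add, Matrix.transpose_transpose,
      Matrix.add_mul, Matrix.trace_add, Matrix.mul_assoc]
  · obtain ⟨D, hD, hd⟩ := gram_hasFDerivAt m n (Wc t)
    have h := hd.comp_hasDerivAt t (hW t)
    have hs : (Φ (Wc t))ᵀ = Φ (Wc t) := by
      rw [hΦ, Matrix.transpose_add, Matrix.transpose_transpose, add_comm]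
    have e : -(((Wc t)ᵀ * Wc t) * Φ (Wc t) + Φ (Wc t) * ((Wc t)ᵀ * Wc t))
        = D (-(Wc t * Φ (Wc t))) := by
      refine Eq.trans ?_ (hD _).symm
      simp only [Matrix.transpose_neg, Matrix.transpose_mul, hs, Matrix.neg_mul, Matrix.mul_neg,
        Matrix.mul_assoc, neg_add]
    rw [e]
    exact h
end
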